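/- Let x, y ∈ Σ^+ and let m_x and m_y be integers such that every output of a global algorithm on x has size at most m_x and every output of a global algorithm on y has size at most m_y. Assume that whenever a string s ∈ Σ^+ with |s| ≥ 2 has two non-overlapping occurrences in the concatenation xy, either both occurrences are contained in x or both are contained in y. Then every output of a global algorithm on xy has size at most m_x + m_y. -/

import Mathlib

/-- A straight-line grammar (SLG) over terminal alphabet `T` with set of nonterminals `N`:
every nonterminal has exactly one production rule (symbols are `N ⊕ T`). -/
structure SLG (T : Type) (N : Type) where
  start : N
  rhs : N → List (N ⊕ T)

namespace SLG

variable {T N : Type}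

/-- One rewriting step: replace one occurrence of a nonterminal by its right-hand side. -/
def Produces (G : SLG T N) (x y : List (N ⊕ T)) : Prop :=
  ∃ (p q : List (N ⊕ T)) (X : N),
    x = p ++ Sum.inl X :: q ∧ y = p ++ G.rhs X ++ q

/-- The derivation relation of an SLG. -/
def Derives (G : SLG T N) : List (N ⊕ T) → List (N ⊕ T) → Prop :=
  Relation.ReflTransGen G.Produces

/-- `u` is the (necessarily unique) expansion `exp_G(X)` of the nonterminal `X`. -/
def IsExp (G : SLG T N) (X : N) (u : List T) : Prop :=
  G.Derives [Sum.inl X] (u.map Sum.inr)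

/-- The language of an SLG; for an SLG it equals `{exp_G(S)}`. -/
def language (G : SLG T N) : Set (List T) :=
  { u | G.IsExp G.start u }

/-- `Y` occurs in the parse tree of `X`. -/
def Reaches (G : SLG T N) : N → N → Prop :=
  Relation.ReflTransGen (fun X Y => Sum.inl Y ∈ G.rhs X)

/-- An SLG is admissible if every right-hand side consists of exactly two symbols and
every nonterminal occurs in the parse tree of the start symbol. -/
def Admissible (G : SLG T N) : Prop :=
  (∀ X, (G.rhs X).length = 2) ∧ (∀ X, G.Reaches G.start X)

/-- The size of an SLG: the total length of the right-hand sides of all its rules. -/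
def size (G : SLG T N) [Fintype N] : ℕ :=
  ∑ X : N, (G.rhs X).length

end SLG

section Occurrences

variable {A : Type}

/-- The set of starting positions (0-indexed) of occurrences of `p` as a substring of `t`. -/
def occSet [DecidableEq A] (p t : List A) : Finset ℕ :=
  (Finset.range (t.length + 1)).filter fun q =>
    q + p.length ≤ t.length ∧ (t.drop q).take p.length = p

/-- Any two occurrences of `p` in `t` are non-overlapping. -/
def PairwiseNonOverlap [DecidableEq A] (p t : List A) : Prop :=
  ∀ q₁ ∈ occSet p t, ∀ q₂ ∈ occSet p t, q₁ < q₂ → q₁ + p.length ≤ q₂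

end Occurrences

section Greedy

variable {A B : Type}

/-- The number of non-overlapping occurrences of `p` in a list, found by the greedy
left-to-right scan (after finding an occurrence at position `i`, the search resumes at
position `i + |p|`). -/
def greedyCount [DecidableEq A] (p : List A) : List A → ℕ
  | [] => 0
  | a :: t =>
    if p ≠ [] ∧ p <+: (a :: t) then 1 + greedyCount p (t.drop (p.length - 1))
    else greedyCount p t
termination_by l => l.length
decreasing_by
  · simp only [List.length_drop, List.length_cons]; omega
  · simp only [List.length_cons]; omega

/-- Replace the greedily found non-overlapping occurrences of `p` in a list by the single
symbol `c`, mapping all remaining symbols by `f`. -/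
def greedyReplace [DecidableEq A] (p : List A) (c : B) (f : A → B) : List A → List B
  | [] => []
  | a :: t =>
    if p ≠ [] ∧ p <+: (a :: t) then c :: greedyReplace p c f (t.drop (p.length - 1))
    else f a :: greedyReplace p c f t
termination_by l => l.length
decreasing_by
  · simp only [List.length_drop, List.length_cons]; omega
  · simp only [List.length_cons]; omega

end Greedy

namespace SLG

variable {T N : Type}

/-- Total number of non-overlapping occurrences of the string `s` on the right-hand side
of the grammar `H` (greedy left-to-right scan of the definition of every nonterminal). -/
def rhsOccs [Fintype N] [DecidableEq N] [DecidableEq T] (H : SLG T N)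
    (s : List (N ⊕ T)) : ℕ :=
  ∑ X : N, greedyCount s (H.rhs X)

/-- `s` is a maximal string with respect to the grammar `H`: it has length at least two,
it has at least two non-overlapping occurrences on the right-hand side of `H`, and no
strictly longer string has at least as many non-overlapping occurrences. -/
def IsMaximal [Fintype N] [DecidableEq N] [DecidableEq T] (H : SLG T N)
    (s : List (N ⊕ T)) : Prop :=
  2 ≤ s.length ∧ 2 ≤ H.rhsOccs s ∧
    ∀ s' : List (N ⊕ T), s.length < s'.length → H.rhsOccs s' < H.rhsOccs s

/-- A single step of a global algorithm on `H` with chosen maximal string `s`: a fresh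
nonterminal (modelled by `none : Option N`) gets `s` as its definition, and the
non-overlapping occurrences of `s` (greedy left-to-right scan) on every right-hand side
are replaced by it. -/
def globalStep [DecidableEq N] [DecidableEq T] (H : SLG T N) (s : List (N ⊕ T)) :
    SLG T (Option N) where
  start := some H.start
  rhs := fun
    | some X => greedyReplace s (Sum.inl none) (Sum.map some id) (H.rhs X)
    | none => s.map (Sum.map some id)

/-- Isomorphism of SLGs over a common terminal alphabet: a bijection of the nonterminals
(extended by the identity on terminals) mapping start symbol to start symbol and the
right-hand side of every nonterminal symbol-by-symbol onto the right-hand side of its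
image. -/
def Isomorphic {N₁ N₂ : Type} (H₁ : SLG T N₁) (H₂ : SLG T N₂) : Prop :=
  ∃ g : N₁ ≃ N₂, g H₁.start = H₂.start ∧
    ∀ X, H₂.rhs (g X) = (H₁.rhs X).map (Sum.map g id)

/-- Renaming the nonterminals of an SLG along a bijection. -/
def relabel {N₁ N₂ : Type} (H : SLG T N₁) (g : N₁ ≃ N₂) : SLG T N₂ where
  start := g H.start
  rhs Y := (H.rhs (g.symm Y)).map (Sum.map g id)

end SLG

/-- The initial grammar of a global algorithm on the input string `w`: a single
nonterminal whose definition is `w`. -/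
def initSLG {T : Type} (w : List T) : SLG T (Fin 1) where
  start := 0
  rhs _ := w.map Sum.inr

/-- `Gs` is (the trace of) a run of `K` steps of a global algorithm on the input
string `w`: it starts with the one-rule grammar for `w` and each step replaces some
maximal string of the current grammar (after each step the nonterminals are renamed to
`Fin (k + 2)`, which keeps a uniform indexing and does not change the grammar up to
isomorphism). -/
def IsGlobalRun {T : Type} [DecidableEq T] (w : List T) (K : ℕ)
    (Gs : (k : ℕ) → SLG T (Fin (k + 1))) : Prop :=
  Gs 0 = initSLG w ∧
  ∀ k < K, ∃ s, (Gs k).IsMaximal s ∧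
    Gs (k + 1) = ((Gs k).globalStep s).relabel (finSuccEquiv (k + 1)).symm


section Straddling

variable {A : Type}

/-- `s` has an occurrence in `L ++ R` that crosses the boundary between `L` and `R`. -/
def Straddles (s L R : List A) : Prop :=
  ∃ s₁ s₂ L' R', s₁ ≠ [] ∧ s₂ ≠ [] ∧ s = s₁ ++ s₂ ∧ L = L' ++ s₁ ∧ R = s₂ ++ R'

theorem Straddles.append_left {s L R : List A} (h : Straddles s L R) (u : List A) :
    Straddles s (u ++ L) R := by
  obtain ⟨s₁, s₂, L', R', h₁, h₂, rfl, rfl, rfl⟩ := h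
  exact ⟨s₁, s₂, u ++ L', R', h₁, h₂, rfl, by simp, rfl⟩

theorem straddles_of_isPrefix {s L R : List A} (hL : L ≠ []) (h : s <+: L ++ R)
    (h' : ¬ s <+: L) : Straddles s L R := by
  obtain ⟨r, hr⟩ := h
  obtain ⟨z, rfl, rfl⟩ | ⟨z, rfl, rfl⟩ := List.append_eq_append_iff.mp hr
  · exact absurd (List.prefix_append _ _) h'
  · refine ⟨L, z, [], r, hL, ?_, rfl, rfl, rfl⟩
    rintro rfl
    simp at h'

end Straddling

section GreedyLemmas

variable {A B C : Type} [DecidableEq A]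

theorem greedyReplace_cons_of_isPrefix {p : List A} (c : B) (f : A → B) {a : A} {t : List A}
    (hp : p ≠ []) (h : p <+: a :: t) :
    greedyReplace p c f (a :: t) = c :: greedyReplace p c f (t.drop (p.length - 1)) := by
  rw [greedyReplace, if_pos ⟨hp, h⟩]

theorem greedyReplace_cons_of_not_isPrefix {p : List A} (c : B) (f : A → B) {a : A} {t : List A}
    (h : ¬ p <+: a :: t) :
    greedyReplace p c f (a :: t) = f a :: greedyReplace p c f t := by
  rw [greedyReplace, if_neg (fun h' => h h'.2)]

/-- Induction along the greedy scan for a nonempty string `p`. -/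
theorem greedy_induction {p : List A} (hp : p ≠ []) {motive : List A → Prop}
    (nil : motive []) (hit : ∀ t, motive t → motive (p ++ t))
    (miss : ∀ a t, ¬ p <+: a :: t → motive t → motive (a :: t)) (l : List A) : motive l := by
  induction hn : l.length using Nat.strong_induction_on generalizing l with
  | _ n ih =>
    cases l with
    | nil => exact nil
    | cons a t =>
      by_cases h : p <+: a :: t
      · obtain ⟨r, hr⟩ := h
        rw [← hr]
        refine hit r (ih r.length ?_ r rfl)
        have := congrArg List.length hr
        have := List.length_pos_iff.mpr hp
        simp at *
        omega
      · exact miss a t h (ih t.length (by simp at hn; omega) t rfl)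

theorem greedyReplace_append_self {p : List A} (hp : p ≠ []) (c : B) (f : A → B) (t : List A) :
    greedyReplace p c f (p ++ t) = c :: greedyReplace p c f t := by
  obtain ⟨a, q, rfl⟩ := List.exists_cons_of_ne_nil hp
  rw [List.cons_append, greedyReplace_cons_of_isPrefix c f hp (by simp)]
  simp

theorem greedyReplace_nil (p : List A) (c : B) (f : A → B) : greedyReplace p c f [] = [] := by
  rw [greedyReplace]

theorem greedyCount_append_self {p : List A} (hp : p ≠ []) (t : List A) :
    greedyCount p (p ++ t) = greedyCount p t + 1 := by
  obtain ⟨a, q, rfl⟩ := List.exists_cons_of_ne_nil hp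
  rw [List.cons_append, greedyCount, if_pos ⟨hp, by simp⟩]
  simp [add_comm]

theorem greedyCount_nil (p : List A) : greedyCount p [] = 0 := by
  rw [greedyCount]

theorem greedyCount_cons_of_not_isPrefix {p : List A} {a : A} {t : List A}
    (h : ¬ p <+: a :: t) : greedyCount p (a :: t) = greedyCount p t := by
  rw [greedyCount, if_neg (fun h' => h h'.2)]

theorem greedyCount_eq_count {p : List A} (hp : p ≠ []) (l : List A) :
    greedyCount p l = (greedyReplace p true (fun _ => false) l).count true := by
  induction l using greedy_induction hp with
  | nil => simp [greedyCount_nil, greedyReplace_nil]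
  | hit t ih => simp [greedyCount_append_self hp, greedyReplace_append_self hp, ih]
  | miss a t h ih =>
    simp [greedyCount_cons_of_not_isPrefix h, greedyReplace_cons_of_not_isPrefix _ _ h, ih]

theorem map_greedyReplace {p : List A} (hp : p ≠ []) (c : B) (f : A → B) (g : B → C)
    (l : List A) :
    (greedyReplace p c f l).map g = greedyReplace p (g c) (g ∘ f) l := by
  induction l using greedy_induction hp with
  | nil => simp [greedyReplace_nil]
  | hit t ih => simp [greedyReplace_append_self hp, ih]
  | miss a t h ih => simp [greedyReplace_cons_of_not_isPrefix _ _ h, ih]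

theorem greedyReplace_map [DecidableEq B] {e : A → B} (he : Function.Injective e)
    {p : List A} (hp : p ≠ []) (c : C) (f : B → C) (l : List A) :
    greedyReplace (p.map e) c f (l.map e) = greedyReplace p c (f ∘ e) l := by
  induction l using greedy_induction hp with
  | nil => simp [greedyReplace_nil]
  | hit t ih =>
    rw [List.map_append, greedyReplace_append_self (by simpa using hp),
      greedyReplace_append_self hp, ih]
  | miss a t h ih =>
    have h' : ¬ p.map e <+: e a :: t.map e := by
      rw [← List.map_cons, List.prefix_map_iff_of_injective he]
      exact h
    rw [List.map_cons, greedyReplace_cons_of_not_isPrefix _ _ h',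
      greedyReplace_cons_of_not_isPrefix _ _ h, ih]
    rfl

theorem greedyCount_map [DecidableEq B] {e : A → B} (he : Function.Injective e)
    {p : List A} (hp : p ≠ []) (l : List A) :
    greedyCount (p.map e) (l.map e) = greedyCount p l := by
  rw [greedyCount_eq_count (by simpa using hp), greedyReplace_map he hp,
    greedyCount_eq_count hp]
  rfl

theorem greedyReplace_of_not_isInfix {p : List A} (hp : p ≠ []) (c : B) (f : A → B) {l : List A}
    (h : ¬ p <:+: l) : greedyReplace p c f l = l.map f := by
  induction l using greedy_induction hp with
  | nil => simp [greedyReplace_nil]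
  | hit t ih => exact absurd (List.prefix_append p t).isInfix h
  | miss a t h' ih =>
    rw [greedyReplace_cons_of_not_isPrefix _ _ h',
      ih fun hi => h (hi.trans (List.suffix_cons a t).isInfix), List.map_cons]

theorem greedyCount_of_not_isInfix {p : List A} (hp : p ≠ []) {l : List A}
    (h : ¬ p <:+: l) : greedyCount p l = 0 := by
  rw [greedyCount_eq_count hp, greedyReplace_of_not_isInfix hp _ _ h]
  simp [List.count_replicate]

theorem mem_greedyReplace {p : List A} (hp : p ≠ []) (c : B) (f : A → B) {l : List A}
    (h : p <:+: l) : c ∈ greedyReplace p c f l := by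
  induction l using greedy_induction hp with
  | nil => simp_all
  | hit t ih => simp [greedyReplace_append_self hp]
  | miss a t h' ih =>
    rw [greedyReplace_cons_of_not_isPrefix _ _ h']
    exact List.mem_cons_of_mem _ (ih ((List.infix_cons_iff.mp h).resolve_left h'))

theorem infix_of_greedyCount_pos {p : List A} (hp : p ≠ []) {l : List A}
    (h : 0 < greedyCount p l) : p <:+: l := by
  by_contra h'
  rw [greedyCount_of_not_isInfix hp h'] at h
  exact lt_irrefl _ h

theorem greedyCount_pos {p : List A} (hp : p ≠ []) {l : List A} (h : p <:+: l) :
    0 < greedyCount p l := by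
  rw [greedyCount_eq_count hp, List.count_pos_iff]
  exact mem_greedyReplace hp _ _ h

theorem exists_two_occurrences {p : List A} (hp : p ≠ []) {l : List A}
    (h : 2 ≤ greedyCount p l) : ∃ u v w, l = u ++ p ++ v ++ p ++ w := by
  induction l using greedy_induction hp with
  | nil => simp [greedyCount_nil] at h
  | hit t ih =>
    rw [greedyCount_append_self hp] at h
    obtain ⟨v, w, rfl⟩ := infix_of_greedyCount_pos hp (l := t) (by omega)
    exact ⟨[], v, w, by simp⟩
  | miss a t h' ih =>
    rw [greedyCount_cons_of_not_isPrefix h'] at h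
    obtain ⟨u, v, w, rfl⟩ := ih h
    exact ⟨a :: u, v, w, by simp⟩

theorem flatMap_greedyReplace {p : List A} (hp : p ≠ []) (c : B) (f : A → B) (σ : B → List A)
    (hc : σ c = p) (hf : ∀ a, σ (f a) = [a]) (l : List A) :
    (greedyReplace p c f l).flatMap σ = l := by
  induction l using greedy_induction hp with
  | nil => simp [greedyReplace_nil]
  | hit t ih => simp [greedyReplace_append_self hp, ih, hc]
  | miss a t h ih => simp [greedyReplace_cons_of_not_isPrefix _ _ h, ih, hf]

theorem greedyCount_drop {p : List A} (hp : p ≠ []) (l : List A) :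
    (∀ n, greedyCount p (l.drop n) ≤ greedyCount p l) ∧
      ∀ n ≤ p.length, greedyCount p l ≤ greedyCount p (l.drop n) + 1 := by
  induction hn : l.length using Nat.strong_induction_on generalizing l with
  | _ n ih =>
    cases l with
    | nil => simp
    | cons a t =>
      have iht := ih t.length (by simp at hn; omega) t rfl
      by_cases h : p <+: a :: t
      · obtain ⟨r, hr⟩ := h
        have hcount : greedyCount p (a :: t) = greedyCount p r + 1 := by
          rw [← hr, greedyCount_append_self hp]
        have hr' : r = (a :: t).drop p.length := by rw [← hr]; simp
        have hpos := List.length_pos_iff.mpr hp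
        refine ⟨fun m => ?_, fun m hm => ?_⟩
        · cases m with
          | zero => simp
          | succ m =>
            rw [List.drop_succ_cons]
            refine (iht.1 m).trans ?_
            rw [hcount, hr']
            have := iht.2 (p.length - 1) (by omega)
            rwa [← List.drop_succ_cons (a := a), Nat.sub_add_cancel hpos] at this
        · cases m with
          | zero => simp
          | succ m =>
            rw [hcount, hr']
            have := (ih (t.drop m).length (by simp at hn ⊢; omega) _ rfl).1 (p.length - (m + 1))
            rw [← List.drop_succ_cons (i := m) (a := a), List.drop_drop,
              Nat.add_sub_cancel' hm] at this
            omega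
      · rw [greedyCount_cons_of_not_isPrefix h]
        refine ⟨fun m => ?_, fun m hm => ?_⟩
        · cases m with
          | zero => simp [greedyCount_cons_of_not_isPrefix h]
          | succ m => simpa using iht.1 m
        · cases m with
          | zero => simp [greedyCount_cons_of_not_isPrefix h]
          | succ m => simpa using iht.2 m (by omega)

theorem greedyCount_le_append_right {p : List A} (hp : p ≠ []) (u v : List A) :
    greedyCount p v ≤ greedyCount p (u ++ v) := by
  simpa using (greedyCount_drop hp (u ++ v)).1 u.length

theorem greedyCount_le_append_left {p : List A} (hp : p ≠ []) (u v : List A) :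
    greedyCount p u ≤ greedyCount p (u ++ v) := by
  induction u using greedy_induction hp with
  | nil => simp [greedyCount_nil]
  | hit t ih =>
    rw [List.append_assoc, greedyCount_append_self hp, greedyCount_append_self hp]
    omega
  | miss a t h ih =>
    rw [greedyCount_cons_of_not_isPrefix h]
    exact ih.trans (greedyCount_le_append_right hp [a] (t ++ v))

theorem greedyReplace_append {p : List A} (hp : p ≠ []) (c : B) (f : A → B) {L R : List A}
    (h : ¬ Straddles p L R) :
    greedyReplace p c f (L ++ R) = greedyReplace p c f L ++ greedyReplace p c f R := by
  induction L using greedy_induction hp with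
  | nil => simp [greedyReplace_nil]
  | hit t ih =>
    rw [List.append_assoc, greedyReplace_append_self hp, greedyReplace_append_self hp,
      ih fun h' => h (h'.append_left p), List.cons_append]
  | miss a t h' ih =>
    have h'' : ¬ p <+: a :: (t ++ R) := fun hpre =>
      h (straddles_of_isPrefix (by simp) hpre h')
    rw [List.cons_append, greedyReplace_cons_of_not_isPrefix _ _ h'',
      greedyReplace_cons_of_not_isPrefix _ _ h', ih fun hs => h (hs.append_left [a]),
      List.cons_append]

theorem greedyCount_append {p : List A} (hp : p ≠ []) {L R : List A}
    (h : ¬ Straddles p L R) :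
    greedyCount p (L ++ R) = greedyCount p L + greedyCount p R := by
  simp only [greedyCount_eq_count hp, greedyReplace_append hp _ _ h, List.count_append]

end GreedyLemmas

section Separation

variable {A B : Type}

/-- No string of length at least two occurs both in a member of `P` and in a member of `Q`. -/
def NoCommonFactor (P Q : Set (List A)) : Prop :=
  ∀ s : List A, 2 ≤ s.length → ∀ p ∈ P, ∀ q ∈ Q, s <:+: p → ¬ s <:+: q

/-- A string crossing the boundary between `L` and `R` has no further occurrence disjoint from
the crossing one in `L ++ R`, and none in a member of `W`. -/
def CrossingUnique (L R : List A) (W : Set (List A)) : Prop :=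
  ∀ s₁ s₂ L' R', s₁ ≠ [] → s₂ ≠ [] → L = L' ++ s₁ → R = s₂ ++ R' →
    ¬ s₁ ++ s₂ <:+: L' ∧ ¬ s₁ ++ s₂ <:+: R' ∧ ∀ w ∈ W, ¬ s₁ ++ s₂ <:+: w

theorem NoCommonFactor.symm {P Q : Set (List A)} (h : NoCommonFactor P Q) :
    NoCommonFactor Q P :=
  fun s hs q hq p hp hsq hsp => h s hs p hp q hq hsp hsq

theorem infix_flatMap_apply_of_mem {c : B} {l : List B} (h : c ∈ l) (σ : B → List A) :
    σ c <:+: l.flatMap σ := by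
  obtain ⟨u, v, rfl⟩ := List.append_of_mem h
  exact ⟨u.flatMap σ, v.flatMap σ, by simp⟩

theorem exists_of_infix_map {f : A → B} {s : List B} {l : List A} (h : s <:+: l.map f) :
    ∃ t, s = t.map f ∧ t <:+: l := by
  obtain ⟨u, v, h⟩ := h
  obtain ⟨l', v', rfl, h', rfl⟩ := List.map_eq_append_iff.mp h.symm
  obtain ⟨u', t, rfl, rfl, rfl⟩ := List.map_eq_append_iff.mp h'
  exact ⟨t, rfl, u', v', rfl⟩

theorem flatMap_map_of_eq_singleton {f : A → B} {σ : B → List A}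
    (hf : ∀ a, σ (f a) = [a]) (l : List A) : (l.map f).flatMap σ = l := by
  induction l with
  | nil => rfl
  | cons a t ih => simp [hf, ih]

theorem length_le_length_flatMap {σ : B → List A} (hσ : ∀ b, σ b ≠ []) (l : List B) :
    l.length ≤ (l.flatMap σ).length := by
  induction l with
  | nil => simp
  | cons a t ih =>
    have := List.length_pos_iff.mpr (hσ a)
    simp only [List.flatMap_cons, List.length_append, List.length_cons]
    omega

theorem NoCommonFactor.unfold {P Q : Set (List A)} (h : NoCommonFactor P Q) {f : A → B}
    {σ : B → List A} {s : List A} (hf : ∀ a, σ (f a) = [a]) (hσ : ∀ b, σ b ≠ [])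
    (hs : ∃ p ∈ P, s <:+: p) {P' Q' : Set (List B)}
    (hP : ∀ p ∈ P', p.flatMap σ ∈ P ∨ p = s.map f) (hQ : ∀ q ∈ Q', q.flatMap σ ∈ Q) :
    NoCommonFactor P' Q' := by
  intro t ht p hp q hq htp htq
  have ht' := ht.trans (length_le_length_flatMap hσ t)
  rcases hP p hp with hp' | rfl
  · exact h _ ht' _ hp' _ (hQ q hq) (htp.flatMap σ) (htq.flatMap σ)
  · obtain ⟨p, hp', hsp⟩ := hs
    have := htp.flatMap σ
    rw [flatMap_map_of_eq_singleton hf] at this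
    exact h _ ht' _ hp' _ (hQ q hq) (this.trans hsp) (htq.flatMap σ)

theorem CrossingUnique.unfold {L R : List A} {W : Set (List A)} (h : CrossingUnique L R W)
    {f : A → B} {σ : B → List A} {s : List A} {c : B} (hf : ∀ a, σ (f a) = [a])
    (hσ : ∀ b, σ b ≠ []) (hc : σ c = s) (hcf : ∀ a, c ≠ f a) {L₁ R₁ : List B}
    {W₁ : Set (List B)} (hL : L₁.flatMap σ = L) (hR : R₁.flatMap σ = R)
    (hW : ∀ w ∈ W₁, w.flatMap σ ∈ W ∨ w = s.map f)
    (hs : c ∈ L₁ ∨ c ∈ R₁ ∨ ∃ w ∈ W, s <:+: w) : CrossingUnique L₁ R₁ W₁ := by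
  intro s₁ s₂ L' R' h₁ h₂ hL₁ hR₁
  have hne : ∀ t : List B, t ≠ [] → t.flatMap σ ≠ [] := by
    intro t ht
    have := length_le_length_flatMap hσ t
    have := List.length_pos_iff.mpr ht
    exact List.length_pos_iff.mp (by omega)
  obtain ⟨hl, hr, hw⟩ := h (s₁.flatMap σ) (s₂.flatMap σ) (L'.flatMap σ) (R'.flatMap σ)
    (hne _ h₁) (hne _ h₂) (by rw [← hL, hL₁, List.flatMap_append])
    (by rw [← hR, hR₁, List.flatMap_append])
  rw [← List.flatMap_append] at hl hr hw
  refine ⟨fun hi => hl (hi.flatMap σ), fun hi => hr (hi.flatMap σ), fun w hw' hi => ?_⟩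
  rcases hW w hw' with hw'' | rfl
  · exact hw _ hw'' (hi.flatMap σ)
  · obtain ⟨t, ht, -⟩ := exists_of_infix_map hi
    have hnot : c ∉ s₁ ++ s₂ := by
      rw [ht, List.mem_map]
      rintro ⟨a, -, ha⟩
      exact hcf a ha.symm
    rw [List.mem_append, not_or] at hnot
    have hi' := hi.flatMap σ
    rw [flatMap_map_of_eq_singleton hf] at hi'
    rcases hs with hs | hs | ⟨w, hwW, hsw⟩
    · rw [hL₁, List.mem_append] at hs
      have := infix_flatMap_apply_of_mem (hs.resolve_right hnot.1) σ
      rw [hc] at this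
      exact hl (hi'.trans this)
    · rw [hR₁, List.mem_append] at hs
      have := infix_flatMap_apply_of_mem (hs.resolve_left hnot.2) σ
      rw [hc] at this
      exact hr (hi'.trans this)
    · exact hw _ hwW (hi'.trans hsw)

theorem infix_left_of_append_eq {u s v l r : List A} (h : u ++ s ++ v = l ++ r)
    (hle : u.length + s.length ≤ l.length) : s <:+: l := by
  have : u ++ s <+: l :=
    List.prefix_of_prefix_length_le ⟨v, h⟩ (List.prefix_append _ _) (by simpa using hle)
  exact (List.suffix_append u s).isInfix.trans this.isInfix

theorem infix_right_of_append_eq {u s v l r : List A} (h : u ++ s ++ v = l ++ r)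
    (hle : l.length ≤ u.length) : s <:+: r := by
  have : s ++ v <:+ r :=
    List.suffix_of_suffix_length_le ⟨u, by rw [← h, List.append_assoc]⟩ (List.suffix_append _ _)
      (by
        have := congrArg List.length h
        simp only [List.length_append] at this ⊢
        omega)
  exact (List.prefix_append s v).isInfix.trans this.isInfix

theorem exists_split_of_append_eq {u s v l r : List A} (h : u ++ s ++ v = l ++ r)
    (h₁ : u.length < l.length) (h₂ : l.length < u.length + s.length) :
    ∃ s₁ s₂, s₁ ≠ [] ∧ s₂ ≠ [] ∧ s = s₁ ++ s₂ ∧ l = u ++ s₁ ∧ r = s₂ ++ v := by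
  rw [List.append_assoc] at h
  obtain ⟨s₁, rfl, hs⟩ | ⟨z, rfl, hz⟩ := List.append_eq_append_iff.mp h
  · obtain ⟨s₂, rfl, rfl⟩ | ⟨z, rfl, hz⟩ := List.append_eq_append_iff.mp hs.symm
    · refine ⟨s₁, s₂, ?_, ?_, rfl, rfl, rfl⟩ <;> rintro rfl <;> simp at h₁ h₂
    · simp at h₂
  · simp at h₁

theorem CrossingUnique.not_straddles {L R : List A} {W : Set (List A)}
    (h : CrossingUnique L R W) {s u v w : List A} (hLR : ¬ (s <:+: L ∧ s <:+: R))
    (he : L ++ R = u ++ s ++ v ++ s ++ w) : ¬ Straddles s L R := by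
  rintro ⟨s₁, s₂, L', R', h₁, h₂, hs, hL, hR⟩
  obtain ⟨hl, hr, -⟩ := h s₁ s₂ L' R' h₁ h₂ hL hR
  rw [← hs] at hl hr
  have e₁ : u ++ s ++ (v ++ s ++ w) = L ++ R := by simp [he]
  have e₂ : (u ++ s ++ v) ++ s ++ w = L ++ R := by simp [he]
  have n₁ := List.length_pos_iff.mpr h₁
  have n₂ := List.length_pos_iff.mpr h₂
  have nL := congrArg List.length hL
  have ns := congrArg List.length hs
  have nu : (u ++ s ++ v).length = u.length + s.length + v.length := by simp [add_assoc]
  simp only [List.length_append] at nL ns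
  rcases Nat.lt_or_ge u.length L.length with c₁ | c₁
  · rcases Nat.lt_or_ge L.length (u.length + s.length) with c₂ | c₂
    · obtain ⟨t₁, t₂, g₁, g₂, rfl, g, g'⟩ := exists_split_of_append_eq e₁ c₁ c₂
      exact (h t₁ t₂ _ _ g₁ g₂ g g').2.1 ⟨v, w, rfl⟩
    · have o₁ := infix_left_of_append_eq e₁ c₂
      rcases Nat.lt_or_ge (u ++ s ++ v).length L.length with c₃ | c₃
      · rcases Nat.lt_or_ge L.length ((u ++ s ++ v).length + s.length) with c₄ | c₄
        · obtain ⟨t₁, t₂, g₁, g₂, rfl, g, g'⟩ := exists_split_of_append_eq e₂ c₃ c₄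
          exact (h t₁ t₂ _ _ g₁ g₂ g g').1 ⟨u, v, rfl⟩
        · refine hl (infix_left_of_append_eq (r := s₁ ++ R) (e₁.trans (by simp [hL])) ?_)
          omega
      · exact hLR ⟨o₁, infix_right_of_append_eq e₂ c₃⟩
  · refine hr (infix_right_of_append_eq (l := L ++ s₂) (e₂.trans (by simp [hR])) ?_)
    simp only [List.length_append] at nu ⊢
    omega

end Separation

namespace SLG

variable {T : Type}

/-- The induced map on symbols of a renaming of nonterminals. -/
abbrev symMap (T : Type) {M N : Type} (a : M → N) : M ⊕ T → N ⊕ T := Sum.map a id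

theorem symMap_injective {M N : Type} {a : M → N} (ha : Function.Injective a) :
    Function.Injective (symMap T a) :=
  Sum.map_injective.mpr ⟨ha, Function.injective_id⟩

/-- The grammar after a global step, with nonterminals renamed to `Fin (k + 2)`. -/
abbrev finStep [DecidableEq T] {k : ℕ} (H : SLG T (Fin (k + 1))) (s : List (Fin (k + 1) ⊕ T)) :
    SLG T (Fin (k + 2)) :=
  (H.globalStep s).relabel (finSuccEquiv (k + 1)).symm

theorem finStep_start [DecidableEq T] {k : ℕ} (H : SLG T (Fin (k + 1)))
    (s : List (Fin (k + 1) ⊕ T)) : (H.finStep s).start = H.start.succ := by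
  simp [relabel, globalStep]

theorem finStep_rhs_zero [DecidableEq T] {k : ℕ} (H : SLG T (Fin (k + 1)))
    (s : List (Fin (k + 1) ⊕ T)) : (H.finStep s).rhs 0 = s.map (symMap T Fin.succ) := by
  simp only [relabel, globalStep, Equiv.symm_symm, finSuccEquiv_zero, List.map_map]
  congr 1
  funext z
  rcases z with z | z <;> simp

theorem finStep_rhs_succ [DecidableEq T] {k : ℕ} (H : SLG T (Fin (k + 1)))
    {s : List (Fin (k + 1) ⊕ T)} (hs : s ≠ []) (X : Fin (k + 1)) :
    (H.finStep s).rhs X.succ =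
      greedyReplace s (Sum.inl 0) (symMap T Fin.succ) (H.rhs X) := by
  simp only [relabel, globalStep, Equiv.symm_symm, finSuccEquiv_succ]
  rw [map_greedyReplace hs]
  congr 1
  funext z
  rcases z with z | z <;> simp

/-- The embedding of nonterminals after a step whose fresh nonterminal belongs to the embedded
grammar. -/
def consEmb {i k : ℕ} (a : Fin (i + 1) → Fin (k + 1)) : Fin (i + 2) → Fin (k + 2) :=
  Fin.cons 0 (Fin.succ ∘ a)

@[simp] theorem consEmb_zero {i k : ℕ} (a : Fin (i + 1) → Fin (k + 1)) : consEmb a 0 = 0 := rfl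

@[simp] theorem consEmb_succ {i k : ℕ} (a : Fin (i + 1) → Fin (k + 1)) (X : Fin (i + 1)) :
    consEmb a X.succ = (a X).succ := rfl

theorem symMap_consEmb_comp {i k : ℕ} (a : Fin (i + 1) → Fin (k + 1)) :
    symMap T (consEmb a) ∘ symMap T Fin.succ = symMap T Fin.succ ∘ symMap T a := by
  funext z
  rcases z with z | z <;> simp

/-- `G` is the combination of the grammars `Gx` and `Gy`: up to the embeddings `a` and `b` of
nonterminals, the start rule of `G` is the concatenation of the start rules (in either order), the
remaining rules are the disjoint union of the remaining rules, and repeated factors of `G` do not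
mix the two parts. -/
structure Split {i j k : ℕ} (Gx : SLG T (Fin (i + 1))) (Gy : SLG T (Fin (j + 1)))
    (G : SLG T (Fin (k + 1))) (a : Fin (i + 1) → Fin (k + 1)) (b : Fin (j + 1) → Fin (k + 1)) :
    Prop where
  left_injective : Function.Injective a
  right_injective : Function.Injective b
  left_start : a Gx.start = G.start
  right_start : b Gy.start = G.start
  cover : ∀ Z, (∃ X, a X = Z) ∨ ∃ Y, b Y = Z
  disjoint : ∀ X Y, a X = b Y → a X = G.start
  rhs_left : ∀ X, X ≠ Gx.start → G.rhs (a X) = (Gx.rhs X).map (symMap T a)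
  rhs_right : ∀ Y, Y ≠ Gy.start → G.rhs (b Y) = (Gy.rhs Y).map (symMap T b)
  noCommonFactor : NoCommonFactor (Set.range fun X => (Gx.rhs X).map (symMap T a))
    (Set.range fun Y => (Gy.rhs Y).map (symMap T b))
  rhs_start : ∃ L R, G.rhs G.start = L ++ R ∧ CrossingUnique L R (G.rhs '' {G.start}ᶜ) ∧
    (L = (Gx.rhs Gx.start).map (symMap T a) ∧ R = (Gy.rhs Gy.start).map (symMap T b) ∨
      R = (Gx.rhs Gx.start).map (symMap T a) ∧ L = (Gy.rhs Gy.start).map (symMap T b))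

/-- A repeated string does not cross the boundary inside the start rule. -/
theorem not_straddles_of_two_le [DecidableEq T] {k : ℕ} {G : SLG T (Fin (k + 1))}
    {s : List (Fin (k + 1) ⊕ T)} (hs : 2 ≤ s.length) (hc : 2 ≤ G.rhsOccs s)
    {L R : List (Fin (k + 1) ⊕ T)}
    (hG : G.rhs G.start = L ++ R) (hu : CrossingUnique L R (G.rhs '' {G.start}ᶜ))
    (hLR : ¬ (s <:+: L ∧ s <:+: R)) : ¬ Straddles s L R := by
  have hne : s ≠ [] := by rintro rfl; simp at hs
  intro hst
  have hzero : ∀ Z ∈ Finset.univ.erase G.start, greedyCount s (G.rhs Z) = 0 := by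
    intro Z hZ
    refine greedyCount_of_not_isInfix hne ?_
    obtain ⟨s₁, s₂, L', R', h₁, h₂, rfl, hL, hR⟩ := hst
    exact (hu s₁ s₂ L' R' h₁ h₂ hL hR).2.2 _ ⟨Z, Finset.ne_of_mem_erase hZ, rfl⟩
  unfold rhsOccs at hc
  rw [← Finset.add_sum_erase _ _ (Finset.mem_univ G.start), Finset.sum_eq_zero hzero,
    add_zero] at hc
  obtain ⟨u, v, w, e⟩ := exists_two_occurrences hne hc
  exact hu.not_straddles hLR (hG.symm.trans e) hst

namespace Split

variable {i j k : ℕ} {Gx : SLG T (Fin (i + 1))} {Gy : SLG T (Fin (j + 1))}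
  {G : SLG T (Fin (k + 1))} {a : Fin (i + 1) → Fin (k + 1)} {b : Fin (j + 1) → Fin (k + 1)}

theorem symm (h : Split Gx Gy G a b) : Split Gy Gx G b a where
  left_injective := h.right_injective
  right_injective := h.left_injective
  left_start := h.right_start
  right_start := h.left_start
  cover Z := (h.cover Z).symm
  disjoint X Y e := e.trans (h.disjoint Y X e.symm)
  rhs_left := h.rhs_right
  rhs_right := h.rhs_left
  noCommonFactor := h.noCommonFactor.symm
  rhs_start := by
    obtain ⟨L, R, e, hc, h | h⟩ := h.rhs_start
    · exact ⟨L, R, e, hc, Or.inr h.symm⟩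
    · exact ⟨L, R, e, hc, Or.inl h.symm⟩

theorem sum_eq (h : Split Gx Gy G a b) (g : Fin (k + 1) → ℕ) :
    ∑ Z, g Z = g G.start + (∑ X ∈ Finset.univ.erase Gx.start, g (a X) +
      ∑ Y ∈ Finset.univ.erase Gy.start, g (b Y)) := by
  rw [← Finset.add_sum_erase _ g (Finset.mem_univ G.start),
    ← Finset.sum_image (f := g) (g := a) (fun _ _ _ _ e => h.left_injective e),
    ← Finset.sum_image (f := g) (g := b) (fun _ _ _ _ e => h.right_injective e),
    ← Finset.sum_union]
  · congr 2
    ext Z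
    simp only [Finset.mem_erase, Finset.mem_univ, and_true, Finset.mem_union, Finset.mem_image]
    constructor
    · intro hZ
      rcases h.cover Z with ⟨X, rfl⟩ | ⟨Y, rfl⟩
      · exact Or.inl ⟨X, fun e => hZ (by rw [e, h.left_start]), rfl⟩
      · exact Or.inr ⟨Y, fun e => hZ (by rw [e, h.right_start]), rfl⟩
    · rintro (⟨X, hX, rfl⟩ | ⟨Y, hY, rfl⟩) e
      · exact hX (h.left_injective (e.trans h.left_start.symm))
      · exact hY (h.right_injective (e.trans h.right_start.symm))
  · rw [Finset.disjoint_left]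
    simp only [Finset.mem_erase, Finset.mem_univ, and_true, Finset.mem_image]
    rintro _ ⟨X, hX, rfl⟩ ⟨Y, -, e⟩
    exact hX (h.left_injective ((h.disjoint X Y e.symm).trans h.left_start.symm))

/-- A quantity summed over all rules of `G` that is additive on the start rule is the sum of the
corresponding quantities of `Gx` and `Gy`. -/
theorem sum_rhs_eq (h : Split Gx Gy G a b) (φ : List (Fin (k + 1) ⊕ T) → ℕ)
    (hφ : φ (G.rhs G.start) = φ ((Gx.rhs Gx.start).map (symMap T a)) +
      φ ((Gy.rhs Gy.start).map (symMap T b))) :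
    ∑ Z, φ (G.rhs Z) = ∑ X, φ ((Gx.rhs X).map (symMap T a)) +
      ∑ Y, φ ((Gy.rhs Y).map (symMap T b)) := by
  have hx : ∑ X ∈ Finset.univ.erase Gx.start, φ (G.rhs (a X)) =
      ∑ X ∈ Finset.univ.erase Gx.start, φ ((Gx.rhs X).map (symMap T a)) :=
    Finset.sum_congr rfl fun X hX => by rw [h.rhs_left X (Finset.ne_of_mem_erase hX)]
  have hy : ∑ Y ∈ Finset.univ.erase Gy.start, φ (G.rhs (b Y)) =
      ∑ Y ∈ Finset.univ.erase Gy.start, φ ((Gy.rhs Y).map (symMap T b)) :=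
    Finset.sum_congr rfl fun Y hY => by rw [h.rhs_right Y (Finset.ne_of_mem_erase hY)]
  rw [h.sum_eq, hφ, hx, hy, ← Finset.add_sum_erase _ _ (Finset.mem_univ Gx.start),
    ← Finset.add_sum_erase _ _ (Finset.mem_univ Gy.start)]
  omega

theorem size_eq (h : Split Gx Gy G a b) : G.size = Gx.size + Gy.size := by
  unfold size
  rw [h.sum_rhs_eq List.length]
  · simp
  · obtain ⟨L, R, e, -, ⟨rfl, rfl⟩ | ⟨rfl, rfl⟩⟩ := h.rhs_start
    · rw [e, List.length_append]
    · rw [e, List.length_append, add_comm]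

section Counting

variable [DecidableEq T]

theorem sum_greedyCount_left_le (h : Split Gx Gy G a b) {s : List (Fin (k + 1) ⊕ T)}
    (hs : s ≠ []) : ∑ X, greedyCount s ((Gx.rhs X).map (symMap T a)) ≤ G.rhsOccs s := by
  unfold rhsOccs
  rw [h.sum_eq, ← Finset.add_sum_erase _ _ (Finset.mem_univ Gx.start),
    Finset.sum_congr rfl fun X hX => by rw [← h.rhs_left X (Finset.ne_of_mem_erase hX)],
    ← add_assoc]
  refine le_add_right (Nat.add_le_add_right ?_ _)
  obtain ⟨L, R, e, -, ⟨rfl, rfl⟩ | ⟨rfl, rfl⟩⟩ := h.rhs_start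
  · rw [e]
    exact greedyCount_le_append_left hs _ _
  · rw [e]
    exact greedyCount_le_append_right hs _ _

theorem rhsOccs_left (h : Split Gx Gy G a b) {s : List (Fin (i + 1) ⊕ T)} (hs : s ≠ []) :
    Gx.rhsOccs s = ∑ X, greedyCount (s.map (symMap T a)) ((Gx.rhs X).map (symMap T a)) :=
  Finset.sum_congr rfl fun X _ =>
    (greedyCount_map (symMap_injective h.left_injective) hs (Gx.rhs X)).symm

theorem rhsOccs_left_le (h : Split Gx Gy G a b) {s : List (Fin (i + 1) ⊕ T)} (hs : s ≠ []) :
    Gx.rhsOccs s ≤ G.rhsOccs (s.map (symMap T a)) := by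
  rw [h.rhsOccs_left hs]
  exact h.sum_greedyCount_left_le (by simpa using hs)

/-- A repeated string does not cross the boundary inside the start rule. -/
theorem rhs_start_not_straddles (h : Split Gx Gy G a b) {s : List (Fin (k + 1) ⊕ T)}
    (hs : 2 ≤ s.length) (hc : 2 ≤ G.rhsOccs s) :
    ∃ L R, G.rhs G.start = L ++ R ∧ CrossingUnique L R (G.rhs '' {G.start}ᶜ) ∧
      (L = (Gx.rhs Gx.start).map (symMap T a) ∧ R = (Gy.rhs Gy.start).map (symMap T b) ∨
        R = (Gx.rhs Gx.start).map (symMap T a) ∧ L = (Gy.rhs Gy.start).map (symMap T b)) ∧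
      ¬ Straddles s L R := by
  obtain ⟨L, R, e, hu, he⟩ := h.rhs_start
  refine ⟨L, R, e, hu, he, not_straddles_of_two_le hs hc e hu ?_⟩
  rintro ⟨h₁, h₂⟩
  rcases he with ⟨rfl, rfl⟩ | ⟨rfl, rfl⟩
  · exact h.noCommonFactor s hs _ ⟨_, rfl⟩ _ ⟨_, rfl⟩ h₁ h₂
  · exact h.noCommonFactor s hs _ ⟨_, rfl⟩ _ ⟨_, rfl⟩ h₂ h₁

theorem rhsOccs_eq (h : Split Gx Gy G a b) {s : List (Fin (k + 1) ⊕ T)}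
    (hs : 2 ≤ s.length) (hc : 2 ≤ G.rhsOccs s) :
    G.rhsOccs s = ∑ X, greedyCount s ((Gx.rhs X).map (symMap T a)) +
      ∑ Y, greedyCount s ((Gy.rhs Y).map (symMap T b)) := by
  have hne : s ≠ [] := by rintro rfl; simp at hs
  refine h.sum_rhs_eq (greedyCount s) ?_
  obtain ⟨L, R, e, -, ⟨rfl, rfl⟩ | ⟨rfl, rfl⟩, hst⟩ := h.rhs_start_not_straddles hs hc
  · rw [e, greedyCount_append hne hst]
  · rw [e, greedyCount_append hne hst, add_comm]

theorem sum_greedyCount_eq_zero (h : Split Gx Gy G a b) {s : List (Fin (k + 1) ⊕ T)}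
    (hs : 2 ≤ s.length) : ∑ X, greedyCount s ((Gx.rhs X).map (symMap T a)) = 0 ∨
      ∑ Y, greedyCount s ((Gy.rhs Y).map (symMap T b)) = 0 := by
  have hne : s ≠ [] := by rintro rfl; simp at hs
  by_contra! hcon
  obtain ⟨X, -, hX⟩ := Finset.exists_ne_zero_of_sum_ne_zero hcon.1
  obtain ⟨Y, -, hY⟩ := Finset.exists_ne_zero_of_sum_ne_zero hcon.2
  exact h.noCommonFactor s hs _ ⟨X, rfl⟩ _ ⟨Y, rfl⟩
    (infix_of_greedyCount_pos hne (Nat.pos_of_ne_zero hX))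
    (infix_of_greedyCount_pos hne (Nat.pos_of_ne_zero hY))

theorem map_greedyReplace_consEmb (ha : Function.Injective a) {s : List (Fin (i + 1) ⊕ T)}
    (hs : s ≠ []) (l : List (Fin (i + 1) ⊕ T)) :
    greedyReplace (s.map (symMap T a)) (Sum.inl 0) (symMap T Fin.succ) (l.map (symMap T a)) =
      (greedyReplace s (Sum.inl 0) (symMap T Fin.succ) l).map (symMap T (consEmb a)) := by
  rw [greedyReplace_map (symMap_injective ha) hs, map_greedyReplace hs, symMap_consEmb_comp]
  rfl

/-- A global step on a string occurring only in the part of `Gx` is a global step on `Gx`. -/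
theorem step_left (h : Split Gx Gy G a b) {s : List (Fin (k + 1) ⊕ T)} (hmax : G.IsMaximal s)
    (hy : ∑ Y, greedyCount s ((Gy.rhs Y).map (symMap T b)) = 0) :
    ∃ s₀, Gx.IsMaximal s₀ ∧
      Split (Gx.finStep s₀) Gy (G.finStep s) (consEmb a) (Fin.succ ∘ b) := by
  obtain ⟨hs, hc, hlt⟩ := hmax
  have hne : s ≠ [] := by rintro rfl; simp at hs
  have hsum := h.rhsOccs_eq hs hc
  rw [hy, add_zero] at hsum
  have hx : ∑ X, greedyCount s ((Gx.rhs X).map (symMap T a)) ≠ 0 := by omega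
  obtain ⟨X₀, -, hX₀⟩ := Finset.exists_ne_zero_of_sum_ne_zero hx
  have hinf := infix_of_greedyCount_pos hne (Nat.pos_of_ne_zero hX₀)
  obtain ⟨s₀, rfl, -⟩ := exists_of_infix_map hinf
  have hne₀ : s₀ ≠ [] := by rintro rfl; simp at hne
  rw [← h.rhsOccs_left hne₀] at hsum
  have hynot : ∀ Y, ¬ s₀.map (symMap T a) <:+: (Gy.rhs Y).map (symMap T b) := by
    intro Y hi
    have := greedyCount_pos hne hi
    have := Finset.sum_eq_zero_iff.mp hy Y (Finset.mem_univ Y)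
    omega
  have hyrep : ∀ Y, greedyReplace (s₀.map (symMap T a)) (Sum.inl 0) (symMap T Fin.succ)
      ((Gy.rhs Y).map (symMap T b)) = (Gy.rhs Y).map (symMap T (Fin.succ ∘ b)) := by
    intro Y
    rw [greedyReplace_of_not_isInfix hne _ _ (hynot Y), List.map_map]
    congr 1
    funext z
    rcases z with z | z <;> simp
  have hzero : (G.finStep (s₀.map (symMap T a))).rhs 0 =
      ((Gx.finStep s₀).rhs 0).map (symMap T (consEmb a)) := by
    rw [finStep_rhs_zero, finStep_rhs_zero, List.map_map, List.map_map, symMap_consEmb_comp]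
  let σ : Fin (k + 2) ⊕ T → List (Fin (k + 1) ⊕ T) :=
    Sum.elim (Fin.cons (s₀.map (symMap T a)) fun Z => [Sum.inl Z]) fun t => [Sum.inr t]
  have hσf : ∀ z, σ (symMap T Fin.succ z) = [z] := by
    rintro (z | z) <;> simp [σ]
  have hσc : σ (Sum.inl 0) = s₀.map (symMap T a) := rfl
  have hσne : ∀ z, σ z ≠ [] := by
    rintro (z | z)
    · refine Fin.cases hne (fun z => ?_) z
      simp [σ]
    · simp [σ]
  have hσrep := flatMap_greedyReplace hne (Sum.inl 0) (symMap T Fin.succ) σ hσc hσf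
  obtain ⟨L, R, e, hu, he, hst⟩ := h.rhs_start_not_straddles hs hc
  refine ⟨s₀, ⟨by simpa using hs, hsum ▸ hc, fun s' hs' => ?_⟩, ?_⟩
  · have hs'ne : s' ≠ [] := by rintro rfl; simp at hs'
    refine (h.rhsOccs_left_le hs'ne).trans_lt ?_
    rw [← hsum]
    exact hlt _ (by simpa using hs')
  · refine
      { left_injective := ?_
        right_injective := (Fin.succ_injective _).comp h.right_injective
        left_start := by simp [finStep_start, h.left_start]
        right_start := by simp [finStep_start, h.right_start]
        cover := ?_
        disjoint := ?_
        rhs_left := ?_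
        rhs_right := ?_
        noCommonFactor := ?_
        rhs_start := ?_ }
    · intro X
      refine Fin.cases (fun Y => ?_) (fun X Y => ?_) X
      · refine Fin.cases (by simp) (fun Y => ?_) Y
        intro e
        exact absurd e.symm (Fin.succ_ne_zero _)
      · refine Fin.cases (fun e => absurd e (Fin.succ_ne_zero _)) (fun Y e => ?_) Y
        exact congrArg Fin.succ (h.left_injective (Fin.succ_injective _ e))
    · refine Fin.cases (Or.inl ⟨0, rfl⟩) fun Z => ?_
      rcases h.cover Z with ⟨X, rfl⟩ | ⟨Y, rfl⟩
      · exact Or.inl ⟨X.succ, rfl⟩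
      · exact Or.inr ⟨Y, rfl⟩
    · intro X Y
      refine Fin.cases (fun e => absurd e.symm (Fin.succ_ne_zero _)) (fun X e => ?_) X
      rw [finStep_start, consEmb_succ, h.disjoint X Y (Fin.succ_injective _ e)]
    · refine Fin.cases (fun _ => hzero) fun X hX => ?_
      have hX' : X ≠ Gx.start := by
        rintro rfl
        exact hX (finStep_start Gx s₀).symm
      rw [consEmb_succ, finStep_rhs_succ _ hne, finStep_rhs_succ _ hne₀, h.rhs_left X hX',
        map_greedyReplace_consEmb h.left_injective hne₀]
    · intro Y hY
      rw [Function.comp_apply, finStep_rhs_succ _ hne, h.rhs_right Y hY, hyrep]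
    · refine h.noCommonFactor.unfold hσf hσne ⟨_, ⟨X₀, rfl⟩, hinf⟩ ?_ ?_
      · rintro _ ⟨X, rfl⟩
        refine Fin.cases (Or.inr ?_) (fun X => Or.inl ⟨X, ?_⟩) X
        · exact hzero.symm.trans (finStep_rhs_zero _ _)
        · simp only [finStep_rhs_succ _ hne₀]
          rw [← map_greedyReplace_consEmb h.left_injective hne₀, hσrep]
      · rintro _ ⟨Y, rfl⟩
        refine ⟨Y, ?_⟩
        simp only [← hyrep, hσrep]
    · refine ⟨greedyReplace (s₀.map (symMap T a)) (Sum.inl 0) (symMap T Fin.succ) L,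
        greedyReplace (s₀.map (symMap T a)) (Sum.inl 0) (symMap T Fin.succ) R, ?_, ?_, ?_⟩
      · rw [finStep_start, finStep_rhs_succ _ hne, e, greedyReplace_append hne _ _ hst]
      · refine hu.unfold hσf hσne hσc ?_ (hσrep L) (hσrep R) ?_ ?_
        · rintro (z | z)
          · exact fun e => Fin.succ_ne_zero z (Sum.inl_injective e).symm
          · exact Sum.inl_ne_inr
        · rintro _ ⟨Z, hZ, rfl⟩
          revert hZ
          refine Fin.cases (fun _ => Or.inr (finStep_rhs_zero _ _)) (fun Z hZ => Or.inl ?_) Z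
          rw [finStep_rhs_succ _ hne, hσrep]
          refine ⟨Z, ?_, rfl⟩
          rintro rfl
          exact hZ (finStep_start G _).symm
        · by_cases hXs : X₀ = Gx.start
          · subst hXs
            rcases he with ⟨rfl, rfl⟩ | ⟨rfl, rfl⟩
            · exact Or.inl (mem_greedyReplace hne _ _ hinf)
            · exact Or.inr (Or.inl (mem_greedyReplace hne _ _ hinf))
          · refine Or.inr (Or.inr ⟨_, ⟨a X₀, ?_, rfl⟩, ?_⟩)
            · exact fun e => hXs (h.left_injective (e.trans h.left_start.symm))
            · rwa [h.rhs_left X₀ hXs]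
      · rw [finStep_start, finStep_rhs_succ _ hne₀,
          ← map_greedyReplace_consEmb h.left_injective hne₀, ← hyrep]
        rcases he with ⟨rfl, rfl⟩ | ⟨rfl, rfl⟩
        · exact Or.inl ⟨rfl, rfl⟩
        · exact Or.inr ⟨rfl, rfl⟩

end Counting

end Split

/-- `H` is reached from `w` by `k` steps of a global algorithm. -/
def Reachable [DecidableEq T] (w : List T) (k : ℕ) (H : SLG T (Fin (k + 1))) : Prop :=
  ∃ Gs, IsGlobalRun w k Gs ∧ Gs k = H

theorem Reachable.step [DecidableEq T] {w : List T} {k : ℕ} {H : SLG T (Fin (k + 1))}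
    (h : Reachable w k H) {s : List (Fin (k + 1) ⊕ T)} (hs : H.IsMaximal s) :
    Reachable w (k + 1) (H.finStep s) := by
  obtain ⟨Gs, ⟨h₀, hstep⟩, rfl⟩ := h
  refine ⟨Function.update Gs (k + 1) ((Gs k).finStep s), ⟨?_, fun m hm => ?_⟩, by simp⟩
  · rw [Function.update_of_ne (by omega), h₀]
  · rw [Function.update_of_ne (show m ≠ k + 1 by omega)]
    rcases Nat.lt_succ_iff_lt_or_eq.mp hm with hm' | rfl
    · rw [Function.update_of_ne (show m + 1 ≠ k + 1 by omega)]
      exact hstep m hm'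
    · exact ⟨s, hs, by simp⟩

theorem rhsOccs_eq_zero_of_length_lt [DecidableEq T] {k : ℕ} {H : SLG T (Fin (k + 1))}
    {s : List (Fin (k + 1) ⊕ T)} (h : H.size < s.length) : H.rhsOccs s = 0 := by
  refine Finset.sum_eq_zero fun X _ => greedyCount_of_not_isInfix ?_ fun hi => ?_
  · rintro rfl
    simp at h
  · have := hi.length_le
    have := Finset.single_le_sum (f := fun X => (H.rhs X).length) (fun _ _ => Nat.zero_le _)
      (Finset.mem_univ X)
    unfold size at h
    omega

theorem exists_isMaximal [DecidableEq T] {k : ℕ} {H : SLG T (Fin (k + 1))}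
    {s : List (Fin (k + 1) ⊕ T)} (hs : 2 ≤ s.length) (hc : 2 ≤ H.rhsOccs s) :
    ∃ s', H.IsMaximal s' := by
  classical
  have hbound : ∀ n, (∃ s' : List (Fin (k + 1) ⊕ T), s'.length = n ∧ 2 ≤ H.rhsOccs s') →
      n ≤ H.size := by
    rintro _ ⟨s', rfl, hs'⟩
    by_contra hlt
    have := rhsOccs_eq_zero_of_length_lt (H := H) (s := s') (by omega)
    omega
  have hP := Nat.findGreatest_spec
    (P := fun n => ∃ s' : List (Fin (k + 1) ⊕ T), s'.length = n ∧ 2 ≤ H.rhsOccs s')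
    (hbound _ ⟨s, rfl, hc⟩) ⟨s, rfl, hc⟩
  have hle := Nat.le_findGreatest
    (P := fun n => ∃ s' : List (Fin (k + 1) ⊕ T), s'.length = n ∧ 2 ≤ H.rhsOccs s')
    (hbound _ ⟨s, rfl, hc⟩) ⟨s, rfl, hc⟩
  obtain ⟨s', hs', hc'⟩ := hP
  refine ⟨s', by omega, hc', fun t ht => ?_⟩
  by_contra hcon
  have ht' : ∃ s' : List (Fin (k + 1) ⊕ T), s'.length = t.length ∧ 2 ≤ H.rhsOccs s' :=
    ⟨t, rfl, by omega⟩
  have := Nat.le_findGreatest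
    (P := fun n => ∃ s' : List (Fin (k + 1) ⊕ T), s'.length = n ∧ 2 ≤ H.rhsOccs s')
    (hbound _ ht') ht'
  omega

theorem Split.not_isMaximal_left [DecidableEq T] {i j k : ℕ} {Gx : SLG T (Fin (i + 1))}
    {Gy : SLG T (Fin (j + 1))} {G : SLG T (Fin (k + 1))} {a : Fin (i + 1) → Fin (k + 1)}
    {b : Fin (j + 1) → Fin (k + 1)} (h : Split Gx Gy G a b) (hG : ∀ s, ¬ G.IsMaximal s)
    (s : List (Fin (i + 1) ⊕ T)) : ¬ Gx.IsMaximal s := by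
  rintro ⟨hs, hc, -⟩
  have hne : s ≠ [] := by rintro rfl; simp at hs
  obtain ⟨s', hs'⟩ := exists_isMaximal (H := G) (s := s.map (symMap T a)) (by simpa using hs)
    (hc.trans (h.rhsOccs_left_le hne))
  exact hG s' hs'

theorem split_initSLG [DecidableEq T] {x y : List T}
    (hsep : ∀ s : List T, 2 ≤ s.length →
      ∀ q₁ ∈ occSet s (x ++ y), ∀ q₂ ∈ occSet s (x ++ y), q₁ + s.length ≤ q₂ →
        (q₂ + s.length ≤ x.length ∨ x.length ≤ q₁)) :
    Split (initSLG x) (initSLG y) (initSLG (x ++ y)) id id := by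
  have hsep' : ∀ s u v w : List T, 2 ≤ s.length → x ++ y = u ++ s ++ v ++ s ++ w →
      u.length + s.length + v.length + s.length ≤ x.length ∨ x.length ≤ u.length := by
    intro s u v w hs e
    have hocc : ∀ u v : List T, x ++ y = u ++ (s ++ v) → u.length ∈ occSet s (x ++ y) := by
      intro u v e
      rw [e]
      simp [occSet]
    have := hsep s hs _ (hocc u (v ++ s ++ w) (by simp [e]))
      _ (hocc (u ++ s ++ v) w (by simp [e])) (by simp)
    simp only [List.length_append] at this
    omega
  have hfin : ∀ X Y : Fin (0 + 1), X = Y := fun X Y => Subsingleton.elim (α := Fin 1) X Y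
  refine
    { left_injective := Function.injective_id
      right_injective := Function.injective_id
      left_start := rfl
      right_start := rfl
      cover := fun Z => Or.inl ⟨Z, rfl⟩
      disjoint := fun _ _ _ => hfin _ _
      rhs_left := fun X hX => absurd (hfin _ _) hX
      rhs_right := fun X hX => absurd (hfin _ _) hX
      noCommonFactor := ?_
      rhs_start := ⟨x.map Sum.inr, y.map Sum.inr, List.map_append, ?_,
        Or.inl ⟨by simp [initSLG], by simp [initSLG]⟩⟩ }
  · rintro s hs _ ⟨X, rfl⟩ _ ⟨Y, rfl⟩ h₁ h₂
    simp only [initSLG, symMap, Sum.map_id_id, List.map_id] at h₁ h₂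
    obtain ⟨t, rfl, u, v, rfl⟩ := exists_of_infix_map h₁
    obtain ⟨t', ht', u', v', rfl⟩ := exists_of_infix_map h₂
    obtain rfl := List.map_injective_iff.mpr Sum.inr_injective ht'
    rw [List.length_map] at hs
    have := hsep' t u (v ++ u') v' hs (by simp)
    simp only [List.length_append] at this
    omega
  · intro s₁ s₂ L' R' h₁ h₂ hL hR
    obtain ⟨l, t₁, rfl, rfl, rfl⟩ := List.map_eq_append_iff.mp hL
    obtain ⟨t₂, r, rfl, rfl, rfl⟩ := List.map_eq_append_iff.mp hR
    have n₁ := List.length_pos_iff.mpr h₁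
    have n₂ := List.length_pos_iff.mpr h₂
    rw [List.length_map] at n₁ n₂
    rw [← List.map_append]
    refine ⟨fun hi => ?_, fun hi => ?_, ?_⟩
    · obtain ⟨t, ht, u, v, rfl⟩ := exists_of_infix_map hi
      obtain rfl := List.map_injective_iff.mpr Sum.inr_injective ht
      have := hsep' (t₁ ++ t₂) u v r (by simp; omega) (by simp)
      simp only [List.length_append] at this
      omega
    · obtain ⟨t, ht, u, v, rfl⟩ := exists_of_infix_map hi
      obtain rfl := List.map_injective_iff.mpr Sum.inr_injective ht
      have := hsep' (t₁ ++ t₂) l u v (by simp; omega) (by simp)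
      simp only [List.length_append] at this
      omega
    · rintro _ ⟨Z, hZ, -⟩
      exact absurd (hfin _ _) hZ

end SLG

/-- Let `x, y ∈ Σ⁺` and let `m_x`, `m_y` be such that every output of
a global algorithm on `x` (resp. `y`) has size at most `m_x` (resp. `m_y`).  Assume that
whenever a string `s` with `|s| ≥ 2` has two non-overlapping occurrences in `x ++ y`,
either both occurrences are contained in `x` or both are contained in `y`.  Then every
output of a global algorithm on `x ++ y` has size at most `m_x + m_y`. -/
theorem global_concat {T : Type} [DecidableEq T] (x y : List T)
    (hx : x ≠ []) (hy : y ≠ []) (mx my : ℕ)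
    (hmx : ∀ (K : ℕ) (Gs : (k : ℕ) → SLG T (Fin (k + 1))),
      IsGlobalRun x K Gs → (∀ s, ¬ (Gs K).IsMaximal s) → (Gs K).size ≤ mx)
    (hmy : ∀ (K : ℕ) (Gs : (k : ℕ) → SLG T (Fin (k + 1))),
      IsGlobalRun y K Gs → (∀ s, ¬ (Gs K).IsMaximal s) → (Gs K).size ≤ my)
    (hsep : ∀ s : List T, 2 ≤ s.length →
      ∀ q₁ ∈ occSet s (x ++ y), ∀ q₂ ∈ occSet s (x ++ y), q₁ + s.length ≤ q₂ →
        (q₂ + s.length ≤ x.length ∨ x.length ≤ q₁)) :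
    ∀ (K : ℕ) (Gs : (k : ℕ) → SLG T (Fin (k + 1))),
      IsGlobalRun (x ++ y) K Gs → (∀ s, ¬ (Gs K).IsMaximal s) →
        (Gs K).size ≤ mx + my := by
  intro K Gs ⟨h₀, hstep⟩ hmax
  have key : ∀ k ≤ K, ∃ (i j : ℕ) (Gx : SLG T (Fin (i + 1))) (Gy : SLG T (Fin (j + 1)))
      (a : Fin (i + 1) → Fin (k + 1)) (b : Fin (j + 1) → Fin (k + 1)),
      SLG.Reachable x i Gx ∧ SLG.Reachable y j Gy ∧ SLG.Split Gx Gy (Gs k) a b := by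
    intro k
    induction k with
    | zero =>
      intro _
      have hinit : ∀ w : List T, SLG.Reachable w 0 (initSLG w) := fun w =>
        ⟨fun k => ⟨0, fun _ => w.map Sum.inr⟩, ⟨rfl, fun k hk => absurd hk (Nat.not_lt_zero k)⟩,
          rfl⟩
      exact ⟨0, 0, _, _, id, id, hinit x, hinit y, h₀ ▸ SLG.split_initSLG hsep⟩
    | succ k ih =>
      intro hk
      obtain ⟨i, j, Gx, Gy, a, b, hGx, hGy, hsplit⟩ := ih (by omega)
      obtain ⟨s, hs, hnext⟩ := hstep k (by omega)
      rw [hnext]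
      rcases hsplit.sum_greedyCount_eq_zero hs.1 with hzero | hzero
      · obtain ⟨s₀, hs₀, h⟩ := hsplit.symm.step_left hs hzero
        exact ⟨i, j + 1, _, _, _, _, hGx, hGy.step hs₀, h.symm⟩
      · obtain ⟨s₀, hs₀, h⟩ := hsplit.step_left hs hzero
        exact ⟨i + 1, j, _, _, _, _, hGx.step hs₀, hGy, h⟩
  obtain ⟨i, j, Gx, Gy, a, b, ⟨Gxs, hGxs, rfl⟩, ⟨Gys, hGys, rfl⟩, hsplit⟩ := key K le_rfl
  rw [hsplit.size_eq]
  exact Nat.add_le_add (hmx i Gxs hGxs (hsplit.not_isMaximal_left hmax))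
    (hmy j Gys hGys (hsplit.symm.not_isMaximal_left hmax))
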